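/- Theorem 3 (Gaptron mistake bound for the smooth multiclass hinge loss, full information): Let K ≥ 2, d ≥ 1, X > 0, D > 0 and η = 1/(4KX²). Given x_1,…,x_T ∈ ℝ^d with ‖x_t‖ ≤ X and y_1,…,y_T ∈ {1,…,K}, define W_1 = 0 and W_{t+1} = Π_D(W_t − η g_t), where: y_t⋆ is any label maximizing k ↦ ⟨W_t^k, x_t⟩; k̃_t is any label maximizing k ↦ ⟨W_t^k, x_t⟩ over k ≠ y_t; m_t(W,y) = ⟨W^y,x_t⟩ − max_{k≠y}⟨W^k,x_t⟩; m_t⋆ = max_k m_t(W_t,k); and g_t = 2(e_{k̃_t} − e_{y_t}) ⊗ x_t if y_t⋆ ≠ y_t, g_t = 2(1 − m_t⋆)(e_{k̃_t} − e_{y_t}) ⊗ x_t if y_t⋆ = y_t and m_t⋆ < 1, and g_t = 0 if y_t⋆ = y_t and m_t⋆ ≥ 1. Let a_t = (1 − min{1, m_t⋆})². Then for every U ∈ ℝ^{K×d} with ‖U‖ ≤ D: Σ_{t=1}^T [(1 − a_t)·1[y_t⋆ ≠ y_t] + a_t·(K−1)/K] ≤ Σ_{t=1}^T ℓ_t(U)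 + 2KX²‖U‖², where ℓ_t(U) = max{1 − 2m_t(U,y_t), 0} if m_t(U,y_t) ≤ 0 and ℓ_t(U) = (1 − m_t(U,y_t))² if m_t(U,y_t) > 0. -/

import Mathlib

open scoped RealInnerProductSpace BigOperators

/-- Frobenius norm of a `K × d` matrix given by its rows. -/
noncomputable def frob {K d : ℕ} (W : Fin K → EuclideanSpace ℝ (Fin d)) : ℝ :=
  Real.sqrt (∑ k, ‖W k‖ ^ 2)

/-- Euclidean (Frobenius) projection onto the ball of radius `D`. -/
noncomputable def projM {K d : ℕ} (D : ℝ) (V : Fin K → EuclideanSpace ℝ (Fin d)) :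
    Fin K → EuclideanSpace ℝ (Fin d) :=
  if frob V ≤ D then V else fun k => (D / frob V) • V k

/-- Margin `m(W, x, y) = ⟨W^y, x⟩ − max_{k ≠ y} ⟨W^k, x⟩`. -/
noncomputable def margin {K d : ℕ} (W : Fin K → EuclideanSpace ℝ (Fin d))
    (x : EuclideanSpace ℝ (Fin d)) (y : Fin K) : ℝ :=
  ⟪W y, x⟫ - ⨆ k : {k : Fin K // k ≠ y}, ⟪W k.1, x⟫

theorem proj_le {E : Type*} [NormedAddCommGroup E] [InnerProductSpace ℝ E] (D : ℝ) (hD : 0 < D)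
    (V U : E) (hU : ‖U‖ ≤ D) (hV : D < ‖V‖) :
    ‖(D / ‖V‖) • V - U‖ ^ 2 ≤ ‖V - U‖ ^ 2 := by
  rw [norm_sub_sq_real, norm_sub_sq_real, norm_smul, inner_smul_left]
  have hN : 0 < ‖V‖ := hD.trans hV
  have h1 : ⟪V, U⟫ ≤ ‖V‖ * D :=
    (real_inner_le_norm V U).trans (mul_le_mul_of_nonneg_left hU hN.le)
  obtain ⟨s, hs⟩ : ∃ s, s = D / ‖V‖ := ⟨_, rfl⟩
  have hD' : D = s * ‖V‖ := by rw [hs]; field_simp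
  have hs0 : 0 < s := by rw [hs]; positivity
  have hs1 : s < 1 := by rw [hs, div_lt_one hN]; exact hV
  rw [← hs]
  simp only [Real.norm_eq_abs, abs_of_pos hs0, conj_trivial]
  rw [hD'] at h1
  have h2 : 0 ≤ (1 - s) * ((1 + s) * ‖V‖ ^ 2 - 2 * ⟪V, U⟫) := by
    apply mul_nonneg (by linarith)
    nlinarith [mul_nonneg (sub_nonneg.2 hs1.le) (sq_nonneg ‖V‖)]
  nlinarith

theorem frob_eq {K d : ℕ} (W : Fin K → EuclideanSpace ℝ (Fin d)) :
    frob W = ‖WithLp.toLp 2 W‖ := by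
  rw [PiLp.norm_eq_of_L2]; rfl

theorem frob_sq {K d : ℕ} (W : Fin K → EuclideanSpace ℝ (Fin d)) :
    frob W ^ 2 = ∑ k, ‖W k‖ ^ 2 := by
  unfold frob
  exact Real.sq_sqrt (Finset.sum_nonneg fun _ _ => sq_nonneg _)

theorem projM_le {K d : ℕ} (D : ℝ) (hD : 0 < D) (V U : Fin K → EuclideanSpace ℝ (Fin d))
    (hU : frob U ≤ D) : frob (projM D V - U) ^ 2 ≤ frob (V - U) ^ 2 := by
  unfold projM
  split_ifs with h
  · exact le_rfl
  · push Not at h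
    rw [frob_eq] at h hU
    have := proj_le D hD (WithLp.toLp 2 V) (WithLp.toLp 2 U) hU h
    rw [frob_eq, frob_eq, frob_eq]
    exact this

theorem step_eq {K d : ℕ} (A : Fin K → EuclideanSpace ℝ (Fin d)) (x : EuclideanSpace ℝ (Fin d))
    (η c : ℝ) (i j : Fin K) (hij : i ≠ j) :
    ∑ k, ‖A k - η • ((2 * c * ((if k = i then (1 : ℝ) else 0) - if k = j then 1 else 0)) • x)‖ ^ 2
      = ∑ k, ‖A k‖ ^ 2 - 4 * η * c * (⟪A i, x⟫ - ⟪A j, x⟫) + 8 * η ^ 2 * c ^ 2 * ‖x‖ ^ 2 := by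
  have h : ∀ k, ‖A k - η • ((2 * c * ((if k = i then (1 : ℝ) else 0)
      - if k = j then 1 else 0)) • x)‖ ^ 2
      = ‖A k‖ ^ 2 - 4 * η * c * ((if k = i then ⟪A k, x⟫ else 0) - (if k = j then ⟪A k, x⟫ else 0))
        + 4 * η ^ 2 * c ^ 2 * ‖x‖ ^ 2 * ((if k = i then (1 : ℝ) else 0) + if k = j then 1 else 0) := by
    intro k
    rw [smul_smul, norm_sub_sq_real, norm_smul, inner_smul_right, mul_pow, Real.norm_eq_abs, sq_abs]
    by_cases h1 : k = i
    · have h2 : k ≠ j := h1 ▸ hij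
      simp only [h1, if_true, if_neg hij]; ring
    · by_cases h2 : k = j
      · simp only [h1, h2, if_true, if_false, if_neg hij.symm]; ring
      · simp only [h1, h2, if_false]; ring
  simp_rw [h]
  rw [Finset.sum_add_distrib, Finset.sum_sub_distrib, ← Finset.mul_sum, ← Finset.mul_sum,
    Finset.sum_sub_distrib, Finset.sum_add_distrib]
  simp only [Finset.sum_ite_eq', Finset.mem_univ, if_true]
  ring

theorem margin_le {K d : ℕ} (W : Fin K → EuclideanSpace ℝ (Fin d))
    (x : EuclideanSpace ℝ (Fin d)) (y k : Fin K) (hk : k ≠ y) :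
    margin W x y ≤ ⟪W y, x⟫ - ⟪W k, x⟫ := by
  unfold margin
  have := le_ciSup (f := fun k : {k : Fin K // k ≠ y} => ⟪W k.1, x⟫)
    (Set.finite_range _).bddAbove ⟨k, hk⟩
  simp only at this
  linarith

theorem le_margin {K d : ℕ} (hK : 2 ≤ K) (W : Fin K → EuclideanSpace ℝ (Fin d))
    (x : EuclideanSpace ℝ (Fin d)) (y : Fin K) (r : ℝ) (h : ∀ k, k ≠ y → r ≤ ⟪W y, x⟫ - ⟪W k, x⟫) :
    r ≤ margin W x y := by
  unfold margin
  haveI : Nontrivial (Fin K) := Fin.nontrivial_iff_two_le.2 hK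
  obtain ⟨z, hz⟩ := exists_ne y
  haveI : Nonempty {k : Fin K // k ≠ y} := ⟨⟨z, hz⟩⟩
  have := ciSup_le (f := fun k : {k : Fin K // k ≠ y} => ⟪W k.1, x⟫) (c := ⟪W y, x⟫ - r)
    (fun k => by have := h k.1 k.2; linarith)
  linarith

theorem mstar_eq {K d : ℕ} (hK : 2 ≤ K) (W : Fin K → EuclideanSpace ℝ (Fin d))
    (x : EuclideanSpace ℝ (Fin d)) (s : Fin K) (hs : ∀ k, ⟪W k, x⟫ ≤ ⟪W s, x⟫) :
    ⨆ k, margin W x k = margin W x s ∧ 0 ≤ margin W x s := by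
  have h0 : 0 ≤ margin W x s := le_margin hK W x s 0 fun k _ => by linarith [hs k]
  haveI : Nonempty (Fin K) := ⟨s⟩
  refine ⟨le_antisymm (ciSup_le fun k => ?_) (le_ciSup (Set.finite_range _).bddAbove s), h0⟩
  by_cases hk : k = s
  · rw [hk]
  · have := margin_le W x k s (Ne.symm hk)
    linarith [hs k]

/-- one step, given the gradient coefficient -/
theorem one_step {K d : ℕ} (hK : 2 ≤ K) (X D : ℝ) (hX : 0 < X) (hD : 0 < D)
    (η : ℝ) (hη : η = 1 / (4 * K * X ^ 2))
    (x : EuclideanSpace ℝ (Fin d)) (hx : ‖x‖ ≤ X) (i j : Fin K) (hij : i ≠ j)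
    (W W' g U : Fin K → EuclideanSpace ℝ (Fin d)) (hU : frob U ≤ D) (c : ℝ) (hc : 0 ≤ c)
    (hg : g = fun k => (2 * c * ((if k = i then (1 : ℝ) else 0) - if k = j then 1 else 0)) • x)
    (hW' : W' = projM D (fun k => W k - η • g k)) :
    2 * c * (⟪W i, x⟫ - ⟪W j, x⟫) + 2 * c * margin U x j - c ^ 2 / K
      ≤ 2 * K * X ^ 2 * frob (W - U) ^ 2 - 2 * K * X ^ 2 * frob (W' - U) ^ 2 := by
  have h1 := projM_le D hD (fun k => W k - η • g k) U hU
  rw [← hW'] at h1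
  have h2 := step_eq (W - U) x η c i j hij
  rw [← frob_sq (W - U)] at h2
  rw [frob_sq ((fun k => W k - η • g k) - U)] at h1
  have h3 : ∑ k, ‖((fun k => W k - η • g k) - U) k‖ ^ 2
    = ∑ k, ‖(W - U) k - η • ((2 * c * ((if k = i then (1 : ℝ) else 0)
      - if k = j then 1 else 0)) • x)‖ ^ 2 := by
    refine Finset.sum_congr rfl fun k _ => ?_
    rw [hg]
    simp only [Pi.sub_apply]
    congr 2
    abel
  rw [h3, h2] at h1
  simp only [Pi.sub_apply, inner_sub_left] at h1
  have hm := margin_le U x j i hij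
  have hK0 : (0 : ℝ) < K := by exact_mod_cast (by omega : 0 < K)
  have hx2 : ‖x‖ ^ 2 ≤ X ^ 2 := pow_le_pow_left₀ (norm_nonneg _) hx 2
  have hP : (0 : ℝ) < 2 * K * X ^ 2 := by positivity
  have h4 := mul_le_mul_of_nonneg_left h1 hP.le
  have e1 : 2 * K * X ^ 2 * (4 * η) = 2 := by rw [hη]; field_simp
  have e2 : 2 * K * X ^ 2 * (8 * η ^ 2 * c ^ 2 * ‖x‖ ^ 2) ≤ c ^ 2 / K := by
    have : 2 * K * X ^ 2 * (8 * η ^ 2 * c ^ 2 * ‖x‖ ^ 2) = c ^ 2 / K * (‖x‖ ^ 2 / X ^ 2) := by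
      rw [hη]; field_simp; norm_num
    rw [this]
    apply mul_le_of_le_one_right (by positivity)
    rw [div_le_one (by positivity)]; exact hx2
  have e3 := mul_le_mul_of_nonneg_left hm hc
  have e4 : 2 * K * X ^ 2 * (frob (W - U) ^ 2 - 4 * η * c * (⟪W i, x⟫ - ⟪U i, x⟫ -
      (⟪W j, x⟫ - ⟪U j, x⟫)) + 8 * η ^ 2 * c ^ 2 * ‖x‖ ^ 2) =
      2 * K * X ^ 2 * frob (W - U) ^ 2 - 2 * K * X ^ 2 * (4 * η) * (c * (⟪W i, x⟫ - ⟪U i, x⟫ -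
      (⟪W j, x⟫ - ⟪U j, x⟫))) + 2 * K * X ^ 2 * (8 * η ^ 2 * c ^ 2 * ‖x‖ ^ 2) := by ring
  rw [e4, e1] at h4
  linarith

/-- Theorem 3: Gaptron mistake bound for the smooth multiclass hinge loss
(full information). -/
theorem gaptron_smooth_hinge_full_info (K d T : ℕ) (hK : 2 ≤ K) (hd : 1 ≤ d)
    (X D : ℝ) (hX : 0 < X) (hD : 0 < D)
    (η : ℝ) (hη : η = 1 / (4 * K * X ^ 2))
    (x : Fin T → EuclideanSpace ℝ (Fin d)) (hx : ∀ t, ‖x t‖ ≤ X)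
    (y : Fin T → Fin K)
    (W : ℕ → Fin K → EuclideanSpace ℝ (Fin d))
    (ystar : Fin T → Fin K)
    (hystar : ∀ t : Fin T, ∀ k, ⟪W t.1 k, x t⟫ ≤ ⟪W t.1 (ystar t), x t⟫)
    (ktil : Fin T → Fin K)
    (hktil : ∀ t : Fin T, ktil t ≠ y t ∧
      ∀ k, k ≠ y t → ⟪W t.1 k, x t⟫ ≤ ⟪W t.1 (ktil t), x t⟫)
    (mstar : Fin T → ℝ)
    (hmstar : ∀ t : Fin T, mstar t = ⨆ k, margin (W t.1) (x t) k)
    (g : Fin T → Fin K → EuclideanSpace ℝ (Fin d))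
    (hg : ∀ t : Fin T, g t =
      if ystar t ≠ y t then
        (fun k => (2 * ((if k = ktil t then (1 : ℝ) else 0) - if k = y t then 1 else 0))
          • x t)
      else if mstar t < 1 then
        (fun k => (2 * (1 - mstar t) *
          ((if k = ktil t then (1 : ℝ) else 0) - if k = y t then 1 else 0)) • x t)
      else 0)
    (hW0 : W 0 = 0)
    (hWsucc : ∀ t : Fin T, W (t.1 + 1) = projM D (fun k => W t.1 k - η • g t k))
    (a : Fin T → ℝ)
    (ha : ∀ t, a t = (1 - min 1 (mstar t)) ^ 2)
    (U : Fin K → EuclideanSpace ℝ (Fin d)) (hU : frob U ≤ D) :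
    ∑ t : Fin T, ((1 - a t) * (if ystar t ≠ y t then (1 : ℝ) else 0)
        + a t * (((K : ℝ) - 1) / K))
      ≤ ∑ t : Fin T, (if margin U (x t) (y t) ≤ 0
            then max (1 - 2 * margin U (x t) (y t)) 0
            else (1 - margin U (x t) (y t)) ^ 2)
        + 2 * K * X ^ 2 * frob U ^ 2 := by
  have hK0 : (0 : ℝ) < K := by exact_mod_cast (by omega : 0 < K)
  have hK1 : (1 : ℝ) ≤ K := by exact_mod_cast (by omega : 1 ≤ K)
  have key : ∀ t : Fin T, ((1 - a t) * (if ystar t ≠ y t then (1 : ℝ) else 0)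
        + a t * (((K : ℝ) - 1) / K))
      ≤ (if margin U (x t) (y t) ≤ 0
            then max (1 - 2 * margin U (x t) (y t)) 0
            else (1 - margin U (x t) (y t)) ^ 2)
        + (2 * K * X ^ 2 * frob (W t.1 - U) ^ 2 - 2 * K * X ^ 2 * frob (W (t.1 + 1) - U) ^ 2) := by
    intro t
    obtain ⟨hm1, hm0⟩ := mstar_eq hK (W t.1) (x t) (ystar t) (hystar t)
    rw [← hmstar t] at hm1
    rw [← hm1] at hm0
    obtain ⟨hk1, hk2⟩ := hktil t
    have step := one_step hK X D hX hD η hη (x t) (hx t) (ktil t) (y t) hk1 (W t.1) (W (t.1 + 1))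
      (g t) U hU
    have hgt := hg t
    have hfrac : ((K : ℝ) - 1) / K = 1 - 1 / K := by field_simp
    generalize margin U (x t) (y t) = u at *
    have hinv : 1 / (K : ℝ) ≤ 1 := by rw [div_le_one hK0]; exact hK1
    have hinv0 : 0 ≤ 1 / (K : ℝ) := by positivity
    rw [hfrac, ha t]
    by_cases hy : ystar t = y t
    · have hmle := margin_le (W t.1) (x t) (y t) (ktil t) hk1
      have hmge := le_margin hK (W t.1) (x t) (y t) _
        (fun k hk => sub_le_sub_left (hk2 k hk) ⟪W t.1 (y t), x t⟫)
      rw [hy] at hm1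
      rw [← hm1] at hmle hmge
      rw [if_neg (not_not.2 hy)] at hgt ⊢
      by_cases hlt : mstar t < 1
      · rw [if_pos hlt] at hgt
        have := step (1 - mstar t) (by linarith) hgt (hWsucc t)
        rw [min_eq_right hlt.le]
        have e : ⟪W t.1 (ktil t), x t⟫ - ⟪W t.1 (y t), x t⟫ = - mstar t := by linarith
        rw [e, div_eq_mul_one_div] at this
        generalize mstar t = m at *
        have hl : (1 - m) ^ 2 ≤ (if u ≤ 0 then max (1 - 2 * u) 0 else (1 - u) ^ 2)
            + 2 * (1 - m) * (u - m) := by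
          split_ifs with hu
          · have := le_max_left (1 - 2 * u) 0
            nlinarith [mul_nonneg hm0 (neg_nonneg.2 hu), sq_nonneg m]
          · nlinarith [sq_nonneg (u - m)]
        linarith
      · rw [if_neg hlt] at hgt
        have := step 0 le_rfl (by rw [hgt]; ext k; simp) (hWsucc t)
        rw [min_eq_left (not_lt.1 hlt)]
        have hl : 0 ≤ (if u ≤ 0 then max (1 - 2 * u) 0 else (1 - u) ^ 2) := by
          split_ifs
          · exact le_max_right _ _
          · positivity
        norm_num at this ⊢
        linarith
    · have hy' : ystar t ≠ y t := hy
      rw [if_pos hy'] at hgt ⊢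
      have := step 1 zero_le_one (by rw [hgt]; simp) (hWsucc t)
      have h1 := margin_le (W t.1) (x t) (ystar t) (y t) hy'.symm
      rw [← hm1] at h1
      have h2 := hk2 (ystar t) hy'
      have hl : 1 - 2 * u ≤ (if u ≤ 0 then max (1 - 2 * u) 0 else (1 - u) ^ 2) := by
        split_ifs
        · exact le_max_left _ _
        · nlinarith [sq_nonneg u]
      have hb : 1 - (1 - min 1 (mstar t)) ^ 2 ≤ 2 * mstar t := by
        nlinarith [min_le_right 1 (mstar t), sq_nonneg (min 1 (mstar t))]
      have hb2 : 1 / (K : ℝ) * (1 - (1 - min 1 (mstar t)) ^ 2) ≤ 2 * mstar t := by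
        calc _ ≤ 1 / (K : ℝ) * (2 * mstar t) := mul_le_mul_of_nonneg_left hb hinv0
          _ ≤ _ := mul_le_of_le_one_left (by linarith) hinv
      rw [one_pow] at this
      linarith
  refine (Finset.sum_le_sum fun t _ => key t).trans ?_
  rw [Finset.sum_add_distrib]
  refine add_le_add le_rfl ?_
  rw [Fin.sum_univ_eq_sum_range (fun t => 2 * K * X ^ 2 * frob (W t - U) ^ 2
    - 2 * K * X ^ 2 * frob (W (t + 1) - U) ^ 2) T,
    Finset.sum_range_sub' (fun t => 2 * K * X ^ 2 * frob (W t - U) ^ 2)]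
  have e : frob (W 0 - U) ^ 2 = frob U ^ 2 := by
    rw [hW0, frob_sq, frob_sq]; simp
  rw [e]
  have : 0 ≤ 2 * K * X ^ 2 * frob (W T - U) ^ 2 := by positivity
  linarith
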